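/- Let 𝒢 be a small groupoid with only finitely many isomorphism classes of objects, and let ρ : 𝒢 ⥤ ModuleCat ℂ be a functor (a groupoid representation). Fix, for each isomorphism class c of objects of 𝒢, a representative object r(c). Then the limit of ρ (which exists in ModuleCat ℂ) is ℂ-linearly isomorphic to the finite direct sum, over the isomorphism classes c, of the submodules of invariants ρ(r(c))^{Aut(r(c))} = {v ∈ ρ(r(c)) | ρ(g)(v) = v for every automorphism g : r(c) ⟶ r(c)}. -/

import Mathlib

open CategoryTheory CategoryTheory.Limits DirectSum

/-- The submodule of invariant vectors `ρ(X)^{Aut(X)}` of a groupoid representation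
`ρ : 𝒢 ⥤ ModuleCat ℂ` at an object `X`. -/
def invariantsSubmodule {𝒢 : Type} [Groupoid 𝒢] (ρ : 𝒢 ⥤ ModuleCat.{0} ℂ) (X : 𝒢) :
    Submodule ℂ (ρ.obj X) where
  carrier := {v | ∀ g : X ⟶ X, ρ.map g v = v}
  add_mem' := by
    intro a b ha hb g
    rw [map_add, ha g, hb g]
  zero_mem' := by
    intro g
    rw [map_zero]
  smul_mem' := by
    intro c a ha g
    rw [map_smul, ha g]

section Representatives

variable {𝒢 : Type} [Groupoid 𝒢] (ρ : 𝒢 ⥤ ModuleCat.{0} ℂ)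
  (r : Quotient (CategoryTheory.isIsomorphicSetoid 𝒢) → 𝒢)

/-- Transporting a family of invariants from the representatives to an object `X` depends neither
on the representative nor on the morphism used. -/
lemma map_invariants_eq
    (hr : ∀ c, Quotient.mk (CategoryTheory.isIsomorphicSetoid 𝒢) (r c) = c)
    (v : ∀ c, invariantsSubmodule ρ (r c))
    {c d : Quotient (CategoryTheory.isIsomorphicSetoid 𝒢)} {X : 𝒢} (g : r c ⟶ X) (h : r d ⟶ X) :
    ρ.map g (v c).1 = ρ.map h (v d).1 := by
  have hcd : c = d := by
    rw [← hr c, ← hr d]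
    exact Quotient.sound ⟨Groupoid.isoEquivHom _ _ |>.symm (g ≫ Groupoid.inv h)⟩
  subst hcd
  have key := (v c).2 (g ≫ Groupoid.inv h)
  calc ρ.map g (v c).1 = ρ.map ((g ≫ Groupoid.inv h) ≫ h) (v c).1 := by simp
    _ = ρ.map h (ρ.map (g ≫ Groupoid.inv h) (v c).1) := by
      rw [ρ.map_comp (g ≫ Groupoid.inv h) h, ModuleCat.comp_apply]
    _ = ρ.map h (v c).1 := by rw [key]

lemma nonempty_hom_of_representative
    (hr : ∀ c, Quotient.mk (CategoryTheory.isIsomorphicSetoid 𝒢) (r c) = c)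
    (X : 𝒢) :
    Nonempty (r (Quotient.mk (CategoryTheory.isIsomorphicSetoid 𝒢) X) ⟶ X) :=
  (Quotient.exact (hr (Quotient.mk _ X))).map Iso.hom

/-- The cone over `ρ` whose point is the product of the invariants at the representatives. -/
noncomputable def invariantsCone
    (hr : ∀ c, Quotient.mk (CategoryTheory.isIsomorphicSetoid 𝒢) (r c) = c) : Cone ρ where
  pt := ModuleCat.of ℂ (∀ c, invariantsSubmodule ρ (r c))
  π :=
    { app X := ModuleCat.ofHom ((ρ.map (nonempty_hom_of_representative r hr X).some).hom ∘ₗ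
        (invariantsSubmodule ρ _).subtype ∘ₗ LinearMap.proj (Quotient.mk _ X))
      naturality X Y f := by
        ext v
        have := map_invariants_eq ρ r hr v (nonempty_hom_of_representative r hr Y).some
          ((nonempty_hom_of_representative r hr X).some ≫ f)
        rw [ρ.map_comp, ModuleCat.comp_apply] at this
        exact this }

lemma invariantsCone_π_app
    (hr : ∀ c, Quotient.mk (CategoryTheory.isIsomorphicSetoid 𝒢) (r c) = c)
    (v : ∀ c, invariantsSubmodule ρ (r c))
    {c : Quotient (CategoryTheory.isIsomorphicSetoid 𝒢)} {X : 𝒢} (g : r c ⟶ X) :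
    (invariantsCone ρ r hr).π.app X v = ρ.map g (v c).1 :=
  map_invariants_eq ρ r hr v _ g

/-- Restriction of an element of the limit to the representatives. -/
noncomputable def limitToInvariants :
    (limit ρ : ModuleCat.{0} ℂ) →ₗ[ℂ] ∀ c, invariantsSubmodule ρ (r c) :=
  LinearMap.pi fun c => (limit.π ρ (r c)).hom.codRestrict _ fun x g =>
    ConcreteCategory.congr_hom (limit.w ρ g) x

/-- The limit of `ρ` is the product of the invariants at the representatives. -/
noncomputable def limitEquivInvariants
    (hr : ∀ c, Quotient.mk (CategoryTheory.isIsomorphicSetoid 𝒢) (r c) = c) :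
    (limit ρ : ModuleCat.{0} ℂ) ≃ₗ[ℂ] ∀ c, invariantsSubmodule ρ (r c) :=
  LinearEquiv.ofLinearMap (limitToInvariants ρ r) (limit.lift ρ (invariantsCone ρ r hr)).hom
    (by
      refine LinearMap.ext fun v => funext fun c => Subtype.ext ?_
      have hlift := ConcreteCategory.congr_hom
        (limit.lift_π (invariantsCone ρ r hr) (r c)) v
      have happ := invariantsCone_π_app ρ r hr v (𝟙 (r c))
      rw [ρ.map_id, ModuleCat.id_apply] at happ
      exact hlift.trans happ)
    (by
      let f : limit ρ ⟶ (invariantsCone ρ r hr).pt := ModuleCat.ofHom (limitToInvariants ρ r)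
      suffices h : f ≫ limit.lift ρ (invariantsCone ρ r hr) = 𝟙 (limit ρ) from
        congrArg ModuleCat.Hom.hom h
      refine limit.hom_ext fun X => ?_
      rw [Category.assoc, limit.lift_π, Category.id_comp]
      ext x
      exact ConcreteCategory.congr_hom
        (limit.w ρ (nonempty_hom_of_representative r hr X).some) x)

end Representatives

/-- For an essentially finite groupoid `𝒢` and a representation `ρ : 𝒢 ⥤ ModuleCat ℂ`,
the limit of `ρ` is linearly isomorphic to the finite direct sum, over the isomorphism
classes of objects (with chosen representatives `r`), of the invariants
`ρ(r c)^{Aut(r c)}`. -/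
theorem limit_groupoid_rep_iso_directSum_invariants
    (𝒢 : Type) [Groupoid 𝒢] [Finite (Quotient (CategoryTheory.isIsomorphicSetoid 𝒢))]
    (ρ : 𝒢 ⥤ ModuleCat.{0} ℂ)
    (r : Quotient (CategoryTheory.isIsomorphicSetoid 𝒢) → 𝒢)
    (hr : ∀ c, Quotient.mk (CategoryTheory.isIsomorphicSetoid 𝒢) (r c) = c) :
    Nonempty ((limit ρ : ModuleCat.{0} ℂ) ≃ₗ[ℂ]
      ⨁ c : Quotient (CategoryTheory.isIsomorphicSetoid 𝒢),
        invariantsSubmodule ρ (r c)) := by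
  classical
  have := Fintype.ofFinite (Quotient (CategoryTheory.isIsomorphicSetoid 𝒢))
  exact ⟨(limitEquivInvariants ρ r hr).trans
    (DirectSum.linearEquivFunOnFintype ℂ _ fun c => invariantsSubmodule ρ (r c)).symm⟩
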